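/- Let q, B, C, D, E, X be nonzero complex numbers with 0 < |q| < 1 and |C/q³| < 1, generic in the sense that every q-shifted factorial appearing in a denominator below is nonzero. Then Σ_{n∈ℤ} [(1 − BCDEX²q^{2n})/(1 − BCDEX²)]·(BCDEXq,BXq,DXq,EXq;q)_n / (X,BCDX,BCEX,CDEX;q)_n·(C/q³)^n = (q;q)_∞ (1/(Bq);q)_∞ (1/(Dq);q)_∞ (1/(Eq);q)_∞ (BCDEX²q;q)_∞ (q/(BCDEX²);q)_∞ (BC/q;q)_∞ (CD/q;q)_∞ (CE/q;q)_∞ / [(X;q)_∞ (1/(BX);q)_∞ (1/(DX);q)_∞ (1/(EX);q)_∞ (1/(BCDEX);q)_∞ (C/q³;q)_∞ (BCDX;q)_∞ (BCEX;q)_∞ (CDEX;q)_∞]. -/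

import Mathlib

/-- The bilateral `q`-shifted factorial `(a;q)_n` for `n ∈ ℤ`:
`(a;q)_0 = 1`, `(a;q)_n = ∏_{j=0}^{n-1} (1 - a q^j)` for `n ≥ 1`, and
`(a;q)_{-n} = 1 / ∏_{j=1}^{n} (1 - a q^{-j})` for `n ≥ 1`. -/
noncomputable def qPoch (q a : ℂ) (n : ℤ) : ℂ :=
  if 0 ≤ n then ∏ j ∈ Finset.range n.toNat, (1 - a * q ^ j)
  else (∏ j ∈ Finset.range (-n).toNat, (1 - a * q ^ (-(j : ℤ) - 1)))⁻¹

/-- The infinite `q`-shifted factorial `(a;q)_∞ = ∏_{j=0}^{∞} (1 - a q^j)`. -/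
noncomputable def qPochInf (q a : ℂ) : ℂ := ∏' j : ℕ, (1 - a * q ^ j)

/-- The `n`-th term of the bilateral very-well-poised series `T(X;C)`:
`[(1 − BCDEX²q^{2n})/(1 − BCDEX²)] · (BCDEXq,BXq,DXq,EXq;q)_n /
(X,BCDX,BCEX,CDEX;q)_n · (C/q³)^n`. -/
noncomputable def Tterm (q B C D E X : ℂ) (n : ℤ) : ℂ :=
  (1 - B*C*D*E*X^2*q^(2*n)) / (1 - B*C*D*E*X^2) *
  ((qPoch q (B*C*D*E*X*q) n * qPoch q (B*X*q) n * qPoch q (D*X*q) n * qPoch q (E*X*q) n) /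
   (qPoch q X n * qPoch q (B*C*D*X) n * qPoch q (B*C*E*X) n * qPoch q (C*D*E*X) n)) *
  (C/q^3)^n

open Filter

/-- The well-poised product `∏_{j<n} (β - q^j) / (1 - aβq^{j+1})`, which for `β = 1/b` equals
`b^{-n} (b;q)_n / (aq/b;q)_n` and stays meaningful at `β = 0`. -/
noncomputable def wpProd (q a β : ℂ) (n : ℕ) : ℂ :=
  ∏ j ∈ Finset.range n, (β - q ^ j) / (1 - a * β * q ^ (j + 1))

/-- The extension of `wpProd` to all integer indices. -/
noncomputable def wpBilat (q a β : ℂ) : ℤ → ℂ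
  | Int.ofNat n => wpProd q a β n
  | Int.negSucc n => q ^ (n + 1) * wpProd q a⁻¹ (a * β) (n + 1)

/-- The `n`-th term of the (unnormalised) very-well-poised `₆ψ₆` series, in terms of the
reciprocals of the four numerator parameters. -/
noncomputable def vwpTerm (q a β γ δ ε : ℂ) (n : ℤ) : ℂ :=
  (1 - a * q ^ (2 * n)) *
    (wpBilat q a β n * wpBilat q a γ n * wpBilat q a δ n * wpBilat q a ε n) * (q * a ^ 2) ^ n

lemma wpProd_zero (q a β : ℂ) : wpProd q a β 0 = 1 := by simp [wpProd]

lemma wpProd_succ (q a β : ℂ) (n : ℕ) :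
    wpProd q a β (n + 1) = wpProd q a β n * ((β - q ^ n) / (1 - a * β * q ^ (n + 1))) :=
  Finset.prod_range_succ _ _

lemma wpBilat_natCast (q a β : ℂ) (n : ℕ) : wpBilat q a β n = wpProd q a β n := rfl

lemma wpBilat_neg_natCast (q a β : ℂ) (n : ℕ) :
    wpBilat q a β (-n) = q ^ n * wpProd q a⁻¹ (a * β) n := by
  cases n with
  | zero => simp [wpProd, wpBilat]
  | succ n => rfl

lemma wpBilat_succ {q a β : ℂ} (hq : q ≠ 0) (ha : a ≠ 0)
    (h₁ : ∀ j : ℕ, 1 - β * q ^ (j + 1) ≠ 0) (h₂ : ∀ j : ℕ, 1 - a * β * q ^ (j + 1) ≠ 0) (n : ℤ) :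
    wpBilat q a β (n + 1) * (1 - a * β * (q * q ^ n)) = wpBilat q a β n * (β - q ^ n) := by
  obtain ⟨n, rfl | rfl⟩ := n.eq_nat_or_neg
  · have := h₂ n
    rw [show (n : ℤ) + 1 = ((n + 1 : ℕ) : ℤ) by push_cast; ring, wpBilat_natCast, wpBilat_natCast,
      wpProd_succ, zpow_natCast, ← pow_succ', mul_assoc, div_mul_cancel₀ _ this]
  · cases n with
    | zero =>
      have := h₂ 0
      rw [show -((0 : ℕ) : ℤ) + 1 = ((0 + 1 : ℕ) : ℤ) by simp, wpBilat_natCast,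
        wpBilat_neg_natCast, wpProd_succ]
      simp only [wpProd_zero, zero_add, pow_one] at this ⊢
      simp [div_mul_cancel₀ _ this]
    | succ n =>
      have := h₁ n
      rw [show -((n + 1 : ℕ) : ℤ) + 1 = -(n : ℤ) by push_cast; ring, wpBilat_neg_natCast,
        wpBilat_neg_natCast, wpProd_succ, zpow_neg, zpow_natCast, inv_mul_cancel_left₀ ha]
      field_simp
      ring

lemma wpProd_shift {q a β : ℂ} (h₂ : ∀ j : ℕ, 1 - a * β * q ^ (j + 1) ≠ 0) (n : ℕ) :
    wpProd q a β n * ((β * q - 1) * (1 - a * β * q)) * q ^ n =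
      wpProd q a (q * β) n * ((β * q - q ^ n) * (1 - a * β * q * q ^ n)) := by
  induction n with
  | zero => simp [wpProd_zero]
  | succ n ih =>
    have e₁ := h₂ n
    have e₂ := h₂ (n + 1)
    have e₃ : 1 - a * (q * β) * q ^ (n + 1) ≠ 0 := by
      convert e₂ using 2; ring
    rw [wpProd_succ, wpProd_succ]
    have e₄ : 1 - a * β * q * q ^ n ≠ 0 := by convert e₁ using 2; ring
    have : (q * β - q ^ n) / (1 - a * (q * β) * q ^ (n + 1)) *
        (1 - a * β * q * q ^ (n + 1)) = q * β - q ^ n := by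
      rw [div_mul_eq_mul_div, div_eq_iff e₃]; ring
    have h' : (β - q ^ n) / (1 - a * β * q ^ (n + 1)) * (1 - a * β * q * q ^ n) = β - q ^ n := by
      rw [div_mul_eq_mul_div, div_eq_iff e₁]; ring
    linear_combination ((β - q ^ n) / (1 - a * β * q ^ (n + 1)) * q) * ih
      + (q * wpProd q a (q * β) n * (β * q - q ^ n)) * h'
      - (wpProd q a (q * β) n * (β * q - q ^ (n + 1))) * this

lemma wpBilat_shift {q a β : ℂ} (hq : q ≠ 0) (ha : a ≠ 0)
    (h₁ : ∀ j : ℕ, 1 - β * q ^ (j + 1) ≠ 0) (h₂ : ∀ j : ℕ, 1 - a * β * q ^ (j + 1) ≠ 0) (n : ℤ) :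
    wpBilat q a β n * ((β * q - 1) * (1 - a * β * q)) * q ^ n =
      wpBilat q a (q * β) n * ((β * q - q ^ n) * (1 - a * β * q * q ^ n)) := by
  obtain ⟨n, rfl | rfl⟩ := n.eq_nat_or_neg
  · simpa only [wpBilat_natCast, zpow_natCast] using
      wpProd_shift h₂ n
  · have key := wpProd_shift (q := q) (a := a⁻¹) (β := a * β)
      (by simpa only [inv_mul_cancel_left₀ ha] using h₁) n
    rw [inv_mul_cancel_left₀ ha] at key
    rw [wpBilat_neg_natCast, wpBilat_neg_natCast, zpow_neg, zpow_natCast,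
      show a * (q * β) = q * (a * β) by ring]
    have hqn : q ^ n ≠ 0 := pow_ne_zero _ hq
    generalize wpProd q a⁻¹ (a * β) n = u at *
    generalize wpProd q a⁻¹ (q * (a * β)) n = v at *
    field_simp
    linear_combination key

/-- The telescoping certificate behind the contiguous relation for the very-well-poised `₆ψ₆`. -/
noncomputable def vwpCert (q a β γ δ ε : ℂ) (n : ℤ) : ℂ :=
  wpBilat q a (q * β) n * wpBilat q a γ n * wpBilat q a δ n * wpBilat q a ε n *
    ((1 - a * (q * β) * q ^ n) * (1 - a * γ * q ^ n) * (1 - a * δ * q ^ n) *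
      (1 - a * ε * q ^ n)) * (a ^ 2) ^ n

lemma vwpCert_succ_sub {q a β γ δ ε : ℂ} (hq : q ≠ 0) (ha : a ≠ 0)
    (hβ₁ : ∀ j : ℕ, 1 - β * q ^ (j + 1) ≠ 0) (hβ₂ : ∀ j : ℕ, 1 - a * β * q ^ (j + 1) ≠ 0)
    (hγ₁ : ∀ j : ℕ, 1 - γ * q ^ (j + 1) ≠ 0) (hγ₂ : ∀ j : ℕ, 1 - a * γ * q ^ (j + 1) ≠ 0)
    (hδ₁ : ∀ j : ℕ, 1 - δ * q ^ (j + 1) ≠ 0) (hδ₂ : ∀ j : ℕ, 1 - a * δ * q ^ (j + 1) ≠ 0)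
    (hε₁ : ∀ j : ℕ, 1 - ε * q ^ (j + 1) ≠ 0) (hε₂ : ∀ j : ℕ, 1 - a * ε * q ^ (j + 1) ≠ 0)
    (n : ℤ) :
    q * β * (vwpCert q a β γ δ ε (n + 1) - vwpCert q a β γ δ ε n) =
      (1 - q * a ^ 2 * β * γ * δ * ε) * (1 - β * q) * (1 - a * β * q) *
        vwpTerm q a β γ δ ε n -
      (1 - a * β * γ * q) * (1 - a * β * δ * q) * (1 - a * β * ε * q) *
        vwpTerm q a (q * β) γ δ ε n := by
  have r₁ := wpBilat_succ (β := q * β) hq ha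
    (fun j => by convert hβ₁ (j + 1) using 2; ring)
    (fun j => by convert hβ₂ (j + 1) using 2; ring) n
  have r₂ := wpBilat_succ hq ha hγ₁ hγ₂ n
  have r₃ := wpBilat_succ hq ha hδ₁ hδ₂ n
  have r₄ := wpBilat_succ hq ha hε₁ hε₂ n
  have s := wpBilat_shift hq ha hβ₁ hβ₂ n
  have hx : q ^ n ≠ 0 := zpow_ne_zero _ hq
  have hY : (q * a ^ 2) ^ n = q ^ n * (a ^ 2) ^ n := mul_zpow _ _ _
  have hG : vwpCert q a β γ δ ε (n + 1) =
      (wpBilat q a (q * β) n * (q * β - q ^ n)) * (wpBilat q a γ n * (γ - q ^ n)) *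
      (wpBilat q a δ n * (δ - q ^ n)) * (wpBilat q a ε n * (ε - q ^ n)) *
      (a ^ 2 * (a ^ 2) ^ n) := by
    rw [← r₁, ← r₂, ← r₃, ← r₄, vwpCert, zpow_add_one₀ hq, zpow_add_one₀ (pow_ne_zero 2 ha)]
    ring
  rw [hG, vwpCert, vwpTerm, vwpTerm, hY, mul_comm 2 n, zpow_mul]
  norm_cast
  generalize q ^ n = x at *
  generalize (a ^ 2) ^ n = y at *
  generalize wpBilat q a (q * β) n = f₁ at *
  generalize wpBilat q a β n = f₀ at *
  generalize wpBilat q a γ n = f₂ at *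
  generalize wpBilat q a δ n = f₃ at *
  generalize wpBilat q a ε n = f₄ at *
  linear_combination ((1 - q * a ^ 2 * β * γ * δ * ε) * (1 - a * x ^ 2) * f₂ * f₃ * f₄ * y) * s

lemma vwpTerm_neg_natCast {q a : ℂ} (hq : q ≠ 0) (ha : a ≠ 0) (β γ δ ε : ℂ) (n : ℕ) :
    vwpTerm q a β γ δ ε (-n) =
      -a * vwpTerm q a⁻¹ (a * β) (a * γ) (a * δ) (a * ε) n := by
  simp only [vwpTerm, wpBilat_neg_natCast, wpBilat_natCast, mul_comm (2 : ℤ), zpow_mul, zpow_neg,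
    zpow_natCast, mul_pow]
  generalize wpProd q a⁻¹ (a * β) n = u₁
  generalize wpProd q a⁻¹ (a * γ) n = u₂
  generalize wpProd q a⁻¹ (a * δ) n = u₃
  generalize wpProd q a⁻¹ (a * ε) n = u₄
  norm_cast
  have hqn : q ^ n ≠ 0 := pow_ne_zero _ hq
  simp only [inv_pow]
  rw [pow_right_comm a 2 n]
  have han : a ^ n ≠ 0 := pow_ne_zero _ ha
  field_simp
  ring

lemma vwpCert_neg_natCast {q a : ℂ} (hq : q ≠ 0) (ha : a ≠ 0) (β γ δ ε : ℂ) (n : ℕ) :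
    vwpCert q a β γ δ ε (-n) =
      (q ^ n - a * (q * β)) * (q ^ n - a * γ) * (q ^ n - a * δ) * (q ^ n - a * ε) *
      (wpProd q a⁻¹ (a * (q * β)) n * wpProd q a⁻¹ (a * γ) n * wpProd q a⁻¹ (a * δ) n *
        wpProd q a⁻¹ (a * ε) n * (a⁻¹ ^ 2) ^ n) := by
  simp only [vwpCert, wpBilat_neg_natCast, zpow_neg, zpow_natCast, inv_pow]
  have hqn : q ^ n ≠ 0 := pow_ne_zero _ hq
  generalize wpProd q a⁻¹ (a * (q * β)) n = u₁
  generalize wpProd q a⁻¹ (a * γ) n = u₂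
  generalize wpProd q a⁻¹ (a * δ) n = u₃
  generalize wpProd q a⁻¹ (a * ε) n = u₄
  field_simp

lemma tendsto_wpProd_ratio {q : ℂ} (hq : ‖q‖ < 1) (a β : ℂ) :
    Tendsto (fun n : ℕ => (β - q ^ n) / (1 - a * β * q ^ (n + 1))) atTop (nhds β) := by
  have h := tendsto_pow_atTop_nhds_zero_of_norm_lt_one hq
  have h' := (tendsto_add_atTop_iff_nat 1).2 h
  have ht := (h.const_sub β).div ((h'.const_mul (a * β)).const_sub 1) (by simp)
  simp only [mul_zero, sub_zero, div_one] at ht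
  exact ht

lemma summable_wpProd {q : ℂ} (hq : ‖q‖ < 1) (a : ℂ) {β γ δ ε y : ℂ}
    (h : ‖y * β * γ * δ * ε‖ < 1) :
    Summable fun n : ℕ =>
      wpProd q a β n * wpProd q a γ n * wpProd q a δ n * wpProd q a ε n * y ^ n := by
  obtain ⟨r, hr, hr'⟩ := exists_between h
  refine summable_of_ratio_norm_eventually_le hr' ?_
  have ht := (((((tendsto_wpProd_ratio hq a β).mul (tendsto_wpProd_ratio hq a γ)).mul
    (tendsto_wpProd_ratio hq a δ)).mul (tendsto_wpProd_ratio hq a ε)).mul_const y).norm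
  rw [show β * γ * δ * ε * y = y * β * γ * δ * ε by ring] at ht
  filter_upwards [ht.eventually_le_const hr] with n hn
  simp only [wpProd_succ, pow_succ]
  calc _ = ‖(β - q ^ n) / (1 - a * β * q ^ (n + 1)) * ((γ - q ^ n) / (1 - a * γ * q ^ (n + 1))) *
            ((δ - q ^ n) / (1 - a * δ * q ^ (n + 1))) *
            ((ε - q ^ n) / (1 - a * ε * q ^ (n + 1))) * y‖ *
          ‖wpProd q a β n * wpProd q a γ n * wpProd q a δ n * wpProd q a ε n * y ^ n‖ := by
        rw [← norm_mul]; congr 1; simp only [pow_succ]; ring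
    _ ≤ _ := mul_le_mul_of_nonneg_right hn (norm_nonneg _)

lemma summable_continuous_pow_mul {q : ℂ} (hq : ‖q‖ < 1) {p : ℂ → ℂ} (hp : Continuous p)
    {g : ℕ → ℂ} (hg : Summable g) : Summable fun n : ℕ => p (q ^ n) * g n := by
  have h := (hp.tendsto 0).comp (tendsto_pow_atTop_nhds_zero_of_norm_lt_one hq)
  refine summable_of_isBigO_nat hg.norm ?_
  simpa using (h.isBigO_one ℝ).mul (Asymptotics.isBigO_refl g atTop).norm_right

lemma vwpTerm_natCast (q a β γ δ ε : ℂ) (n : ℕ) :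
    vwpTerm q a β γ δ ε n = (1 - a * (q ^ n) ^ 2) *
      (wpProd q a β n * wpProd q a γ n * wpProd q a δ n * wpProd q a ε n * (q * a ^ 2) ^ n) := by
  simp only [vwpTerm, wpBilat_natCast, zpow_natCast, mul_comm (2 : ℤ), zpow_mul]
  norm_cast
  ring

lemma summable_vwpTerm_natCast {q : ℂ} (hq : ‖q‖ < 1) {a β γ δ ε : ℂ}
    (h : ‖q * a ^ 2 * β * γ * δ * ε‖ < 1) :
    Summable fun n : ℕ => vwpTerm q a β γ δ ε n := by
  simp only [vwpTerm_natCast]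
  exact summable_continuous_pow_mul hq (p := fun x => 1 - a * x ^ 2) (by fun_prop)
    (summable_wpProd hq a h)

lemma inv_argument {a : ℂ} (ha : a ≠ 0) (q β γ δ ε : ℂ) :
    q * a⁻¹ ^ 2 * (a * β) * (a * γ) * (a * δ) * (a * ε) = q * a ^ 2 * β * γ * δ * ε := by
  field_simp

lemma summable_vwpTerm {q : ℂ} (hq₀ : q ≠ 0) (hq : ‖q‖ < 1) {a β γ δ ε : ℂ} (ha : a ≠ 0)
    (h : ‖q * a ^ 2 * β * γ * δ * ε‖ < 1) : Summable (vwpTerm q a β γ δ ε) := by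
  refine .of_nat_of_neg (summable_vwpTerm_natCast hq h) ?_
  simp only [vwpTerm_neg_natCast hq₀ ha]
  exact (summable_vwpTerm_natCast hq (by rwa [inv_argument ha])).mul_left _

lemma summable_vwpCert {q : ℂ} (hq₀ : q ≠ 0) (hq : ‖q‖ < 1) {a β γ δ ε : ℂ} (ha : a ≠ 0)
    (h : ‖q * a ^ 2 * β * γ * δ * ε‖ < 1) : Summable (vwpCert q a β γ δ ε) := by
  refine .of_nat_of_neg ?_ ?_
  · have := summable_continuous_pow_mul hq (p := fun x => (1 - a * (q * β) * x) *
      (1 - a * γ * x) * (1 - a * δ * x) * (1 - a * ε * x)) (by fun_prop)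
      (summable_wpProd (β := q * β) (γ := γ) (δ := δ) (ε := ε) (y := a ^ 2) hq a
        (by convert h using 2; ring))
    refine this.congr fun n => ?_
    simp only [vwpCert, wpBilat_natCast, zpow_natCast]
    ring
  · simp only [vwpCert_neg_natCast hq₀ ha]
    refine summable_continuous_pow_mul hq (p := fun x => (x - a * (q * β)) *
      (x - a * γ) * (x - a * δ) * (x - a * ε)) (by fun_prop)
      (summable_wpProd (y := a⁻¹ ^ 2) hq a⁻¹ ?_)
    rw [← inv_argument ha] at h
    convert h using 2; ring

/-- The very-well-poised bilateral series, as a function of the reciprocal parameters. -/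
noncomputable def vwpSum (q a β γ δ ε : ℂ) : ℂ := ∑' n : ℤ, vwpTerm q a β γ δ ε n

lemma vwpSum_rotate (q a β γ δ ε : ℂ) : vwpSum q a β γ δ ε = vwpSum q a γ δ ε β := by
  refine tsum_congr fun n => ?_
  simp only [vwpTerm]
  ring

/-- Non-vanishing of all the denominators attached to one (reciprocal) parameter. -/
def WpGeneric (q a β : ℂ) : Prop :=
  (∀ j : ℕ, 1 - β * q ^ (j + 1) ≠ 0) ∧ ∀ j : ℕ, 1 - a * β * q ^ (j + 1) ≠ 0

lemma WpGeneric.shift {q a β : ℂ} (h : WpGeneric q a β) : WpGeneric q a (q * β) :=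
  ⟨fun j => by convert h.1 (j + 1) using 2; ring, fun j => by convert h.2 (j + 1) using 2; ring⟩

lemma WpGeneric.shift_pow {q a β : ℂ} (h : WpGeneric q a β) (k : ℕ) :
    WpGeneric q a (β * q ^ k) := by
  induction k with
  | zero => simpa using h
  | succ k ih => convert ih.shift using 1; ring

lemma tsum_int_succ_sub {f : ℤ → ℂ} (hf : Summable f) : ∑' n : ℤ, (f (n + 1) - f n) = 0 := by
  have hf' : Summable fun n : ℤ => f (n + 1) := (Equiv.addRight (1 : ℤ)).summable_iff.2 hf
  rw [hf'.tsum_sub hf, sub_eq_zero]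
  exact (Equiv.addRight (1 : ℤ)).tsum_eq f

lemma vwpSum_contiguous {q : ℂ} (hq₀ : q ≠ 0) (hq : ‖q‖ < 1) {a β γ δ ε : ℂ} (ha : a ≠ 0)
    (hz : ‖q * a ^ 2 * β * γ * δ * ε‖ < 1) (hβ : WpGeneric q a β) (hγ : WpGeneric q a γ)
    (hδ : WpGeneric q a δ) (hε : WpGeneric q a ε) :
    (1 - q * a ^ 2 * β * γ * δ * ε) * (1 - β * q) * (1 - a * β * q) * vwpSum q a β γ δ ε =
      (1 - a * β * γ * q) * (1 - a * β * δ * q) * (1 - a * β * ε * q) *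
        vwpSum q a (q * β) γ δ ε := by
  have hz' : ‖q * a ^ 2 * (q * β) * γ * δ * ε‖ < 1 := by
    rw [show q * a ^ 2 * (q * β) * γ * δ * ε = q * (q * a ^ 2 * β * γ * δ * ε) by ring, norm_mul]
    exact mul_lt_one_of_nonneg_of_lt_one_left (norm_nonneg _) hq hz.le
  have hG := summable_vwpCert (β := β) (γ := γ) (δ := δ) (ε := ε) hq₀ hq ha hz
  have key : ∑' n : ℤ, q * β * (vwpCert q a β γ δ ε (n + 1) - vwpCert q a β γ δ ε n) = 0 := by
    rw [tsum_mul_left, tsum_int_succ_sub hG, mul_zero]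
  have h₁ := (summable_vwpTerm hq₀ hq ha hz).mul_left
    ((1 - q * a ^ 2 * β * γ * δ * ε) * (1 - β * q) * (1 - a * β * q))
  have h₂ := (summable_vwpTerm hq₀ hq ha hz').mul_left
    ((1 - a * β * γ * q) * (1 - a * β * δ * q) * (1 - a * β * ε * q))
  rw [tsum_congr (vwpCert_succ_sub hq₀ ha hβ.1 hβ.2 hγ.1 hγ.2 hδ.1 hδ.2 hε.1 hε.2),
    h₁.tsum_sub h₂, tsum_mul_left, tsum_mul_left] at key
  exact sub_eq_zero.1 key
lemma vwpSum_contiguous_all {q : ℂ} (hq₀ : q ≠ 0) (hq : ‖q‖ < 1) {a β γ δ ε : ℂ} (ha : a ≠ 0)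
    (hz : ‖q * a ^ 2 * β * γ * δ * ε‖ < 1) (hβ : WpGeneric q a β) (hγ : WpGeneric q a γ)
    (hδ : WpGeneric q a δ) (hε : WpGeneric q a ε) :
    (1 - q * a ^ 2 * β * γ * δ * ε) * (1 - q * a ^ 2 * β * γ * δ * ε * q) *
        (1 - q * a ^ 2 * β * γ * δ * ε * q ^ 2) * (1 - q * a ^ 2 * β * γ * δ * ε * q ^ 3) *
        ((1 - β * q) * (1 - a * β * q) * ((1 - γ * q) * (1 - a * γ * q)) *
        ((1 - δ * q) * (1 - a * δ * q)) * ((1 - ε * q) * (1 - a * ε * q))) *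
        vwpSum q a β γ δ ε =
      (1 - a * β * γ * q) * (1 - a * β * γ * q * q) * ((1 - a * β * δ * q) *
        (1 - a * β * δ * q * q)) * ((1 - a * β * ε * q) * (1 - a * β * ε * q * q)) *
        ((1 - a * γ * δ * q) * (1 - a * γ * δ * q * q)) * ((1 - a * γ * ε * q) *
        (1 - a * γ * ε * q * q)) * ((1 - a * δ * ε * q) * (1 - a * δ * ε * q * q)) *
        vwpSum q a (q * β) (q * γ) (q * δ) (q * ε) := by
  have hs : ∀ {z w : ℂ}, ‖z‖ < 1 → w = q * z → ‖w‖ < 1 := fun hz hw => by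
    rw [hw, norm_mul]
    exact mul_lt_one_of_nonneg_of_lt_one_left (norm_nonneg _) hq hz.le
  have z₂ : ‖q * a ^ 2 * γ * δ * ε * (q * β)‖ < 1 := hs hz (by ring)
  have z₃ : ‖q * a ^ 2 * δ * ε * (q * β) * (q * γ)‖ < 1 := hs z₂ (by ring)
  have z₄ : ‖q * a ^ 2 * ε * (q * β) * (q * γ) * (q * δ)‖ < 1 := hs z₃ (by ring)
  have c₁ := vwpSum_contiguous hq₀ hq ha hz hβ hγ hδ hε
  have c₂ := vwpSum_contiguous hq₀ hq ha z₂ hγ hδ hε hβ.shift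
  have c₃ := vwpSum_contiguous hq₀ hq ha z₃ hδ hε hβ.shift hγ.shift
  have c₄ := vwpSum_contiguous hq₀ hq ha z₄ hε hβ.shift hγ.shift hδ.shift
  rw [vwpSum_rotate q a (q * β)] at c₁
  rw [vwpSum_rotate q a (q * γ)] at c₂
  rw [vwpSum_rotate q a (q * δ)] at c₃
  rw [vwpSum_rotate q a (q * ε)] at c₄
  generalize vwpSum q a β γ δ ε = s₁ at *
  generalize vwpSum q a γ δ ε (q * β) = s₂ at *
  generalize vwpSum q a δ ε (q * β) (q * γ) = s₃ at *
  generalize vwpSum q a ε (q * β) (q * γ) (q * δ) = s₄ at *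
  generalize vwpSum q a (q * β) (q * γ) (q * δ) (q * ε) = s₅ at *
  generalize hd₁ : (1 - q * a ^ 2 * β * γ * δ * ε) * (1 - β * q) * (1 - a * β * q) = d₁ at c₁
  generalize hd₂ : (1 - q * a ^ 2 * γ * δ * ε * (q * β)) * (1 - γ * q) * (1 - a * γ * q) = d₂ at c₂
  generalize hd₃ : (1 - q * a ^ 2 * δ * ε * (q * β) * (q * γ)) * (1 - δ * q) * (1 - a * δ * q) = d₃
    at c₃
  generalize hd₄ : (1 - q * a ^ 2 * ε * (q * β) * (q * γ) * (q * δ)) * (1 - ε * q) *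
    (1 - a * ε * q) = d₄ at c₄
  generalize hn₁ : (1 - a * β * γ * q) * (1 - a * β * δ * q) * (1 - a * β * ε * q) = n₁ at c₁
  generalize hn₂ : (1 - a * γ * δ * q) * (1 - a * γ * ε * q) * (1 - a * γ * (q * β) * q) = n₂ at c₂
  generalize hn₃ : (1 - a * δ * ε * q) * (1 - a * δ * (q * β) * q) * (1 - a * δ * (q * γ) * q) = n₃
    at c₃
  generalize hn₄ : (1 - a * ε * (q * β) * q) * (1 - a * ε * (q * γ) * q) *
    (1 - a * ε * (q * δ) * q) = n₄ at c₄
  have key : d₁ * d₂ * d₃ * d₄ * s₁ = n₁ * n₂ * n₃ * n₄ * s₅ := by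
    linear_combination d₂ * d₃ * d₄ * c₁ + n₁ * d₃ * d₄ * c₂ + n₁ * n₂ * d₄ * c₃ +
      n₁ * n₂ * n₃ * c₄
  calc _ = d₁ * d₂ * d₃ * d₄ * s₁ := by
        rw [← hd₁, ← hd₂, ← hd₃, ← hd₄]
        rw [show q * a ^ 2 * γ * δ * ε * (q * β) = q * a ^ 2 * β * γ * δ * ε * q by ring,
          show q * a ^ 2 * δ * ε * (q * β) * (q * γ) = q * a ^ 2 * β * γ * δ * ε * q ^ 2 by ring,
          show q * a ^ 2 * ε * (q * β) * (q * γ) * (q * δ) =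
            q * a ^ 2 * β * γ * δ * ε * q ^ 3 by ring]
        ac_rfl
    _ = n₁ * n₂ * n₃ * n₄ * s₅ := key
    _ = _ := by
        rw [← hn₁, ← hn₂, ← hn₃, ← hn₄]
        rw [show a * γ * (q * β) * q = a * β * γ * q * q by ring,
          show a * δ * (q * β) * q = a * β * δ * q * q by ring,
          show a * δ * (q * γ) * q = a * γ * δ * q * q by ring,
          show a * ε * (q * β) * q = a * β * ε * q * q by ring,
          show a * ε * (q * γ) * q = a * γ * ε * q * q by ring,
          show a * ε * (q * δ) * q = a * δ * ε * q * q by ring]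
        ac_rfl

/-- The finite `q`-shifted factorial. -/
noncomputable def qPochFin (q x : ℂ) (k : ℕ) : ℂ := ∏ j ∈ Finset.range k, (1 - x * q ^ j)

lemma qPochFin_succ (q x : ℂ) (k : ℕ) :
    qPochFin q x (k + 1) = qPochFin q x k * (1 - x * q ^ k) :=
  Finset.prod_range_succ _ _

lemma qPochFin_mul_succ_two (q x : ℂ) (k : ℕ) :
    qPochFin q x (2 * (k + 1)) =
      qPochFin q x (2 * k) * ((1 - x * q ^ (2 * k)) * (1 - x * q ^ (2 * k) * q)) := by
  rw [show 2 * (k + 1) = 2 * k + 1 + 1 by ring, qPochFin_succ, qPochFin_succ]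
  ring

lemma qPochFin_mul_succ_four (q x : ℂ) (k : ℕ) :
    qPochFin q x (4 * (k + 1)) =
      qPochFin q x (4 * k) * ((1 - x * q ^ (4 * k)) * (1 - x * q ^ (4 * k) * q) *
        (1 - x * q ^ (4 * k) * q ^ 2) * (1 - x * q ^ (4 * k) * q ^ 3)) := by
  rw [show 4 * (k + 1) = 4 * k + 1 + 1 + 1 + 1 by ring, qPochFin_succ, qPochFin_succ,
    qPochFin_succ, qPochFin_succ]
  ring

lemma vwpSum_iterate {q : ℂ} (hq₀ : q ≠ 0) (hq : ‖q‖ < 1) {a β γ δ ε : ℂ} (ha : a ≠ 0)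
    (hz : ‖q * a ^ 2 * β * γ * δ * ε‖ < 1) (hβ : WpGeneric q a β) (hγ : WpGeneric q a γ)
    (hδ : WpGeneric q a δ) (hε : WpGeneric q a ε) (k : ℕ) :
    qPochFin q (q * a ^ 2 * β * γ * δ * ε) (4 * k) *
        (qPochFin q (β * q) k * qPochFin q (a * β * q) k *
        (qPochFin q (γ * q) k * qPochFin q (a * γ * q) k) *
        (qPochFin q (δ * q) k * qPochFin q (a * δ * q) k) *
        (qPochFin q (ε * q) k * qPochFin q (a * ε * q) k)) * vwpSum q a β γ δ ε =
      qPochFin q (a * β * γ * q) (2 * k) * qPochFin q (a * β * δ * q) (2 * k) *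
        qPochFin q (a * β * ε * q) (2 * k) * qPochFin q (a * γ * δ * q) (2 * k) *
        qPochFin q (a * γ * ε * q) (2 * k) * qPochFin q (a * δ * ε * q) (2 * k) *
        vwpSum q a (β * q ^ k) (γ * q ^ k) (δ * q ^ k) (ε * q ^ k) := by
  induction k with
  | zero => simp [qPochFin]
  | succ k ih =>
    have hz' : q * a ^ 2 * (β * q ^ k) * (γ * q ^ k) * (δ * q ^ k) * (ε * q ^ k) =
        q * a ^ 2 * β * γ * δ * ε * q ^ (4 * k) := by ring
    have step := vwpSum_contiguous_all hq₀ hq ha (β := β * q ^ k) (γ := γ * q ^ k)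
      (δ := δ * q ^ k) (ε := ε * q ^ k) (by
        rw [hz', norm_mul, norm_pow]
        exact mul_lt_one_of_nonneg_of_lt_one_left (norm_nonneg _) hz
          (pow_le_one₀ (norm_nonneg _) hq.le))
      (hβ.shift_pow k) (hγ.shift_pow k) (hδ.shift_pow k) (hε.shift_pow k)
    have e₁ : ∀ x : ℂ, x * q ^ k * q = x * q * q ^ k := fun x => by ring
    have e₂ : ∀ x : ℂ, a * (x * q ^ k) * q = a * x * q * q ^ k := fun x => by ring
    have e₃ : ∀ x y : ℂ, a * (x * q ^ k) * (y * q ^ k) * q = a * x * y * q * q ^ (2 * k) :=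
      fun x y => by ring
    have e₄ : ∀ x : ℂ, q * (x * q ^ k) = x * q ^ (k + 1) := fun x => by ring
    rw [hz'] at step
    simp only [e₂, e₃, e₄] at step
    simp only [e₁] at step
    simp only [qPochFin_mul_succ_two, qPochFin_mul_succ_four, qPochFin_succ]
    generalize vwpSum q a β γ δ ε = s₁ at *
    generalize vwpSum q a (β * q ^ k) (γ * q ^ k) (δ * q ^ k) (ε * q ^ k) = s₂ at *
    generalize vwpSum q a (β * q ^ (k + 1)) (γ * q ^ (k + 1)) (δ * q ^ (k + 1))
      (ε * q ^ (k + 1)) = s₃ at *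
    have combine : ∀ {d n d' n' : ℂ}, d * s₁ = n * s₂ → d' * s₂ = n' * s₃ →
        d * d' * s₁ = n * n' * s₃ := fun {d n d' n'} h h' => by
      linear_combination d' * h + n * h'
    convert combine ih step using 1
    · ac_rfl
    · ac_rfl

lemma tendsto_tsum_of_ratio {g : ℕ → ℕ → ℂ} {g₀ w : ℕ → ℂ} {M : ℝ} (hw : ∀ n, ‖w n‖ ≤ M)
    (h₀ : ∀ n, Tendsto (fun k => g k n) atTop (nhds (g₀ n)))
    (hr : ∀ᶠ p : ℕ × ℕ in atTop, ‖g p.1 (p.2 + 1)‖ ≤ 1 / 2 * ‖g p.1 p.2‖) :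
    Tendsto (fun k => ∑' n, w n * g k n) atTop (nhds (∑' n, w n * g₀ n)) := by
  obtain ⟨⟨K, N⟩, hKN⟩ := eventually_atTop.1 hr
  have hbdd : ∀ n, ∃ C, ∀ k, ‖g k n‖ ≤ C := fun n => by
    obtain ⟨C, hC⟩ := (Metric.isBounded_range_of_tendsto _ (h₀ n)).exists_norm_le
    exact ⟨C, fun k => hC _ ⟨k, rfl⟩⟩
  choose C hC using hbdd
  have hM : 0 ≤ M := (norm_nonneg _).trans (hw 0)
  have hgeom : ∀ k ≥ K, ∀ m, ‖g k (m + N)‖ ≤ C N * (1 / 2) ^ m := fun k hk m => by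
    induction m with
    | zero => simpa using hC N k
    | succ m ih =>
      have := hKN (k, m + N) ⟨hk, Nat.le_add_left _ _⟩
      rw [show m + 1 + N = m + N + 1 by ring, pow_succ]
      simp only at this
      linarith
  refine tendsto_tsum_of_dominated_convergence
    (bound := fun n => M * if n < N then C n else C N * (1 / 2) ^ (n - N)) ?_
    (fun n => (h₀ n).const_mul _) ?_
  · refine Summable.mul_left _ ((summable_nat_add_iff N).1 ?_)
    simpa using summable_geometric_two.mul_left (C N)
  · filter_upwards [eventually_ge_atTop K] with k hk n
    rw [norm_mul]
    refine mul_le_mul (hw n) ?_ (norm_nonneg _) hM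
    split_ifs with hn
    · exact hC n k
    · have := hgeom k hk (n - N)
      rwa [Nat.sub_add_cancel (not_lt.1 hn)] at this

lemma tendsto_wpProd_mul_pow {q : ℂ} (hq : ‖q‖ < 1) (a β : ℂ) (n : ℕ) :
    Tendsto (fun k : ℕ => wpProd q a (β * q ^ k) n) atTop (nhds (wpProd q a 0 n)) := by
  have h := (tendsto_pow_atTop_nhds_zero_of_norm_lt_one hq).const_mul β
  rw [mul_zero] at h
  refine tendsto_finsetProd _ fun j _ => ?_
  exact (h.sub_const _).div (((h.const_mul a).mul_const _).const_sub 1) (by simp)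

lemma tendsto_wpProd_ratio_joint {q : ℂ} (hq : ‖q‖ < 1) (a β : ℂ) :
    Tendsto (fun p : ℕ × ℕ => (β * q ^ p.1 - q ^ p.2) / (1 - a * (β * q ^ p.1) * q ^ (p.2 + 1)))
      atTop (nhds 0) := by
  rw [← prod_atTop_atTop_eq]
  have h := tendsto_pow_atTop_nhds_zero_of_norm_lt_one hq
  have h₁ := (h.comp (tendsto_fst (f := atTop) (g := (atTop : Filter ℕ)))).const_mul β
  have h₂ := h.comp (tendsto_snd (f := (atTop : Filter ℕ)) (g := atTop))
  have h₃ := ((tendsto_add_atTop_iff_nat 1).2 h).comp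
    (tendsto_snd (f := (atTop : Filter ℕ)) (g := atTop))
  have ht := (h₁.sub h₂).div (((h₁.const_mul a).mul h₃).const_sub 1) (by simp)
  simp only [mul_zero, sub_zero, zero_div] at ht
  exact ht

lemma tendsto_tsum_nat_vwpTerm {q : ℂ} (hq : ‖q‖ < 1) (a β γ δ ε : ℂ) :
    Tendsto (fun k : ℕ => ∑' n : ℕ,
        vwpTerm q a (β * q ^ k) (γ * q ^ k) (δ * q ^ k) (ε * q ^ k) n) atTop
      (nhds (∑' n : ℕ, vwpTerm q a 0 0 0 0 n)) := by
  simp only [vwpTerm_natCast]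
  refine tendsto_tsum_of_ratio (M := 1 + ‖a‖) (fun n => ?_) (fun n => ?_) ?_
  · refine (norm_sub_le _ _).trans ?_
    rw [norm_one, norm_mul, norm_pow, norm_pow]
    gcongr
    exact mul_le_of_le_one_right (norm_nonneg _)
      (pow_le_one₀ (by positivity) (pow_le_one₀ (norm_nonneg _) hq.le))
  · exact ((((tendsto_wpProd_mul_pow hq a β n).mul (tendsto_wpProd_mul_pow hq a γ n)).mul
      (tendsto_wpProd_mul_pow hq a δ n)).mul (tendsto_wpProd_mul_pow hq a ε n)).mul_const _
  · have ht := (((((tendsto_wpProd_ratio_joint hq a β).mul (tendsto_wpProd_ratio_joint hq a γ)).mul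
      (tendsto_wpProd_ratio_joint hq a δ)).mul (tendsto_wpProd_ratio_joint hq a ε)).mul_const
      (q * a ^ 2)).norm
    simp only [mul_zero, zero_mul, norm_zero] at ht
    filter_upwards [ht.eventually_le_const (show (0 : ℝ) < 1 / 2 by norm_num)] with p hp
    refine le_trans (le_of_eq ?_) (mul_le_mul_of_nonneg_right hp (norm_nonneg _))
    rw [← norm_mul]
    congr 1
    simp only [wpProd_succ, pow_succ (q * a ^ 2)]
    ring

lemma vwpSum_eq_add {q : ℂ} (hq₀ : q ≠ 0) (hq : ‖q‖ < 1) {a β γ δ ε : ℂ} (ha : a ≠ 0)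
    (hz : ‖q * a ^ 2 * β * γ * δ * ε‖ < 1) :
    vwpSum q a β γ δ ε = ∑' n : ℕ, vwpTerm q a β γ δ ε n +
      -a * ∑' n : ℕ, vwpTerm q a⁻¹ (a * β) (a * γ) (a * δ) (a * ε) n - (1 - a) := by
  have h₂ := (summable_vwpTerm_natCast (q := q) (a := a⁻¹) hq
    (by rwa [inv_argument ha q β γ δ ε])).mul_left (-a)
  simp only [← vwpTerm_neg_natCast hq₀ ha] at h₂
  rw [vwpSum, (summable_vwpTerm_natCast hq hz).tsum_of_nat_of_neg h₂]
  simp only [vwpTerm_neg_natCast hq₀ ha, tsum_mul_left]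
  congr 1
  have := vwpTerm_natCast q a β γ δ ε 0
  simpa [wpProd_zero] using this

lemma tendsto_vwpSum {q : ℂ} (hq₀ : q ≠ 0) (hq : ‖q‖ < 1) {a β γ δ ε : ℂ} (ha : a ≠ 0)
    (hz : ‖q * a ^ 2 * β * γ * δ * ε‖ < 1) :
    Tendsto (fun k : ℕ => vwpSum q a (β * q ^ k) (γ * q ^ k) (δ * q ^ k) (ε * q ^ k)) atTop
      (nhds (vwpSum q a 0 0 0 0)) := by
  have hz' : ∀ k : ℕ,
      ‖q * a ^ 2 * (β * q ^ k) * (γ * q ^ k) * (δ * q ^ k) * (ε * q ^ k)‖ < 1 := fun k => by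
    rw [show q * a ^ 2 * (β * q ^ k) * (γ * q ^ k) * (δ * q ^ k) * (ε * q ^ k) =
      q * a ^ 2 * β * γ * δ * ε * q ^ (4 * k) by ring, norm_mul, norm_pow]
    exact mul_lt_one_of_nonneg_of_lt_one_left (norm_nonneg _) hz
      (pow_le_one₀ (norm_nonneg _) hq.le)
  rw [vwpSum_eq_add hq₀ hq ha (by simp)]
  simp only [fun k => vwpSum_eq_add hq₀ hq ha (hz' k), mul_zero]
  simp only [← mul_assoc a]
  exact ((tendsto_tsum_nat_vwpTerm hq a β γ δ ε).add
    ((tendsto_tsum_nat_vwpTerm hq a⁻¹ _ _ _ _).const_mul _)).sub_const _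

lemma summable_norm_mul_pow {q : ℂ} (hq : ‖q‖ < 1) (x : ℂ) :
    Summable fun j : ℕ => ‖-(x * q ^ j)‖ := by
  simp only [norm_neg, norm_mul, norm_pow]
  exact (summable_geometric_of_lt_one (norm_nonneg _) hq).mul_left _

lemma tendsto_qPochFin {q : ℂ} (hq : ‖q‖ < 1) (x : ℂ) :
    Tendsto (qPochFin q x) atTop (nhds (qPochInf q x)) := by
  have h := (multipliable_one_add_of_summable (summable_norm_mul_pow hq x)).hasProd.tendsto_prod_nat
  simp only [← sub_eq_add_neg] at h
  exact h

lemma one_sub_mul_pow_ne_zero {q x : ℂ} (h : qPochInf q x ≠ 0) (j : ℕ) : 1 - x * q ^ j ≠ 0 :=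
  fun hj => h (tprod_of_exists_eq_zero ⟨j, hj⟩)

lemma norm_mul_pow_lt_one {q x : ℂ} (hq : ‖q‖ < 1) (hx : ‖x‖ < 1) (j : ℕ) :
    ‖x * q ^ j‖ < 1 := by
  rw [norm_mul, norm_pow]
  exact mul_lt_one_of_nonneg_of_lt_one_left (norm_nonneg _) hx
    (pow_le_one₀ (norm_nonneg _) hq.le)

lemma one_sub_ne_zero_of_norm_lt_one {x : ℂ} (hx : ‖x‖ < 1) : 1 - x ≠ 0 := fun h => by
  rw [← sub_eq_zero.1 h, norm_one] at hx
  exact lt_irrefl _ hx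

lemma qPochInf_ne_zero {q x : ℂ} (hq : ‖q‖ < 1) (hx : ‖x‖ < 1) : qPochInf q x ≠ 0 := by
  have := tprod_one_add_ne_zero_of_summable (f := fun j : ℕ => -(x * q ^ j))
    (fun j => by
      rw [← sub_eq_add_neg]
      exact one_sub_ne_zero_of_norm_lt_one (norm_mul_pow_lt_one hq hx j))
    (summable_norm_mul_pow hq x)
  simp only [← sub_eq_add_neg] at this
  exact this

lemma qPochInf_eq_mul {q : ℂ} (hq : ‖q‖ < 1) (x : ℂ) :
    qPochInf q x = (1 - x) * qPochInf q (x * q) := by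
  refine tendsto_nhds_unique ((tendsto_add_atTop_iff_nat 1).2 (tendsto_qPochFin hq x)) ?_
  refine ((tendsto_qPochFin hq (x * q)).const_mul (1 - x)).congr fun k => ?_
  rw [qPochFin, qPochFin, Finset.prod_range_succ', mul_comm]
  simp only [pow_zero, mul_one]
  congr 1
  exact Finset.prod_congr rfl fun j _ => by ring

lemma vwpSum_mul_eq {q : ℂ} (hq₀ : q ≠ 0) (hq : ‖q‖ < 1) {a β γ δ ε : ℂ} (ha : a ≠ 0)
    (hz : ‖q * a ^ 2 * β * γ * δ * ε‖ < 1) (hβ : WpGeneric q a β) (hγ : WpGeneric q a γ)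
    (hδ : WpGeneric q a δ) (hε : WpGeneric q a ε) :
    qPochInf q (q * a ^ 2 * β * γ * δ * ε) *
        (qPochInf q (β * q) * qPochInf q (a * β * q) *
        (qPochInf q (γ * q) * qPochInf q (a * γ * q)) *
        (qPochInf q (δ * q) * qPochInf q (a * δ * q)) *
        (qPochInf q (ε * q) * qPochInf q (a * ε * q))) * vwpSum q a β γ δ ε =
      qPochInf q (a * β * γ * q) * qPochInf q (a * β * δ * q) *
        qPochInf q (a * β * ε * q) * qPochInf q (a * γ * δ * q) *
        qPochInf q (a * γ * ε * q) * qPochInf q (a * δ * ε * q) * vwpSum q a 0 0 0 0 := by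
  have h := tendsto_qPochFin hq
  have h₂ := fun x => (h x).comp (tendsto_id.const_mul_atTop' (show 0 < 2 by norm_num))
  have h₄ := (h (q * a ^ 2 * β * γ * δ * ε)).comp
    (tendsto_id.const_mul_atTop' (show 0 < 4 by norm_num))
  have hl := (h₄.mul (((((h (β * q)).mul (h (a * β * q))).mul
    ((h (γ * q)).mul (h (a * γ * q)))).mul ((h (δ * q)).mul (h (a * δ * q)))).mul
    ((h (ε * q)).mul (h (a * ε * q))))).mul_const (vwpSum q a β γ δ ε)
  have hr := ((((((h₂ (a * β * γ * q)).mul (h₂ (a * β * δ * q))).mul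
    (h₂ (a * β * ε * q))).mul (h₂ (a * γ * δ * q))).mul (h₂ (a * γ * ε * q))).mul
    (h₂ (a * δ * ε * q))).mul (tendsto_vwpSum hq₀ hq ha hz)
  exact tendsto_nhds_unique hl
    (hr.congr fun k => (vwpSum_iterate hq₀ hq ha hz hβ hγ hδ hε k).symm)

lemma wpProd_one_of_ne_zero (q a : ℂ) (n : ℕ) (hn : n ≠ 0) : wpProd q a 1 n = 0 :=
  Finset.prod_eq_zero (Finset.mem_range.2 (Nat.pos_of_ne_zero hn)) (by simp)

lemma vwpSum_inv_one {a : ℂ} (ha : a ≠ 0) (q γ δ : ℂ) : vwpSum q a a⁻¹ γ δ 1 = 1 - a := by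
  rw [vwpSum, tsum_eq_single 0]
  · simpa [wpProd_zero] using vwpTerm_natCast q a a⁻¹ γ δ 1 0
  · intro n hn
    obtain ⟨n, rfl | rfl⟩ := n.eq_nat_or_neg
    · simp [vwpTerm, wpBilat_natCast, wpProd_one_of_ne_zero q a n (by simpa using hn)]
    · simp [vwpTerm, wpBilat_neg_natCast, mul_inv_cancel₀ ha,
        wpProd_one_of_ne_zero q a⁻¹ n (by simpa using hn)]

lemma wpBilat_zero_pow_four {q a : ℂ} (hq : q ≠ 0) (ha : a ≠ 0) (n : ℤ) :
    wpBilat q a 0 n ^ 4 = q ^ (2 * n * (n - 1)) := by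
  have step : ∀ n : ℤ, wpBilat q a 0 (n + 1) ^ 4 = wpBilat q a 0 n ^ 4 * q ^ (4 * n) := fun n => by
    have := wpBilat_succ hq ha (β := 0) (by simp) (by simp) n
    simp only [mul_zero, zero_mul, sub_zero, mul_one, zero_sub] at this
    rw [this, mul_comm 4 n, zpow_mul]
    norm_cast
    ring
  induction n using Int.induction_on with
  | zero => simp [show wpBilat q a 0 0 = 1 from wpProd_zero q a 0]
  | succ n ih =>
    rw [step, ih, ← zpow_add₀ hq]
    congr 1
    ring
  | pred n ih =>
    have := step (-n - 1)
    rw [sub_add_cancel, ih] at this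
    rw [← mul_left_inj' (zpow_ne_zero (4 * (-(n : ℤ) - 1)) hq), ← this, ← zpow_add₀ hq]
    congr 1
    ring

lemma vwpSum_zero_zpow {q : ℂ} (hq : q ≠ 0) (m : ℤ) : vwpSum q (q ^ m) 0 0 0 0 = 0 := by
  have ht : ∀ n : ℤ, vwpTerm q (q ^ m) 0 0 0 0 n =
      (1 - q ^ (m + 2 * n)) * q ^ (2 * n ^ 2 - n + 2 * m * n) := fun n => by
    have h4 := wpBilat_zero_pow_four hq (zpow_ne_zero m hq) n
    have hy : (q * (q ^ m) ^ 2) ^ n = q ^ ((1 + m * 2) * n) := by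
      rw [zpow_mul, zpow_add₀ hq, zpow_mul, zpow_one]
      norm_cast
    rw [vwpTerm, hy, zpow_add₀ hq,
      show 2 * n ^ 2 - n + 2 * m * n = 2 * n * (n - 1) + (1 + m * 2) * n by ring,
      zpow_add₀ hq (2 * n * (n - 1)), ← h4]
    ring
  have hsymm : ∀ n : ℤ, vwpTerm q (q ^ m) 0 0 0 0 (-m - n) = -vwpTerm q (q ^ m) 0 0 0 0 n :=
    fun n => by
      rw [ht, ht, show 2 * (-m - n) ^ 2 - (-m - n) + 2 * m * (-m - n) =
        (m + 2 * n) + (2 * n ^ 2 - n + 2 * m * n) by ring,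
        show m + 2 * (-m - n) = -(m + 2 * n) by ring, zpow_neg, zpow_add₀ hq (m + 2 * n)]
      have := zpow_ne_zero (m + 2 * n) hq
      field_simp
      ring
  have h := (Equiv.subLeft (-m)).tsum_eq (vwpTerm q (q ^ m) 0 0 0 0)
  simp only [Equiv.subLeft_apply, hsymm, tsum_neg] at h
  exact self_eq_neg.1 h.symm

/-- The Jacobi triple product identity, for the series obtained from the very-well-poised
`₆ψ₆` series when all four numerator parameters tend to infinity. -/
lemma vwpSum_zero {q : ℂ} (hq₀ : q ≠ 0) (hq : ‖q‖ < 1) {a : ℂ} (ha : a ≠ 0) :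
    vwpSum q a 0 0 0 0 = (1 - a) * qPochInf q (a * q) * qPochInf q (q / a) * qPochInf q q := by
  by_cases hm : ∃ m : ℤ, a = q ^ m
  · obtain ⟨m, rfl⟩ := hm
    rw [vwpSum_zero_zpow hq₀, ← qPochInf_eq_mul hq]
    rcases le_or_gt m 0 with h | h
    · obtain ⟨k, rfl⟩ := Int.exists_eq_neg_ofNat h
      have : qPochInf q (q ^ (-(k : ℤ))) = 0 := by
        by_contra hne
        apply one_sub_mul_pow_ne_zero hne k
        simp [hq₀]
      rw [this, zero_mul, zero_mul]
    · obtain ⟨k, rfl⟩ := Int.eq_succ_of_zero_lt h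
      have : qPochInf q (q / q ^ ((k : ℤ) + 1)) = 0 := by
        by_contra hne
        apply one_sub_mul_pow_ne_zero hne k
        rw [zpow_add_one₀ hq₀, zpow_natCast]
        field_simp
        simp
      rw [this]
      simp
  · push Not at hm
    obtain ⟨γ, hγ1, hγ2⟩ : ∃ γ : ℂ, ‖γ‖ ≤ 1 ∧ ‖a * γ‖ ≤ 1 := by
      refine ⟨((1 + ‖a‖ : ℝ) : ℂ)⁻¹, ?_, ?_⟩
      · rw [norm_inv, Complex.norm_real, Real.norm_of_nonneg (by positivity)]
        exact inv_le_one_of_one_le₀ (by linarith [norm_nonneg a])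
      · rw [norm_mul, norm_inv, Complex.norm_real, Real.norm_of_nonneg (by positivity),
          ← div_eq_mul_inv]
        exact div_le_one_of_le₀ (by linarith) (by positivity)
    have hmul : ∀ {x : ℂ}, ‖x‖ ≤ 1 → ‖x * q‖ < 1 := fun hx => by
      rw [norm_mul]
      exact mul_lt_one_of_nonneg_of_lt_one_right hx (norm_nonneg _) hq
    have hgen : ∀ {x : ℂ}, ‖x‖ ≤ 1 → ∀ j : ℕ, 1 - x * q ^ (j + 1) ≠ 0 := fun hx j =>
      one_sub_ne_zero_of_norm_lt_one (by
        rw [pow_succ', ← mul_assoc]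
        exact norm_mul_pow_lt_one hq (hmul hx) j)
    have gγ : WpGeneric q a γ := ⟨hgen hγ1, hgen hγ2⟩
    have g₁ : WpGeneric q a 1 := ⟨hgen norm_one.le, fun j h => hm (-(j + 1 : ℕ)) (by
      rw [zpow_neg, zpow_natCast]
      rw [mul_one] at h
      exact eq_inv_of_mul_eq_one_left (sub_eq_zero.1 h).symm)⟩
    have gβ : WpGeneric q a a⁻¹ := ⟨fun j h => hm (j + 1 : ℕ) (by
      rw [zpow_natCast]
      have := (sub_eq_zero.1 h).symm
      rwa [inv_mul_eq_one₀ ha] at this), by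
      rw [mul_inv_cancel₀ ha]
      exact hgen norm_one.le⟩
    have hz₀ : q * a ^ 2 * a⁻¹ * γ * γ * 1 = a * γ * γ * q := by field_simp
    have hz : ‖a * γ * γ * q‖ < 1 := hmul (by
      rw [norm_mul]
      exact mul_le_one₀ hγ2 (norm_nonneg _) hγ1)
    have key := vwpSum_mul_eq hq₀ hq ha (by rwa [hz₀]) gβ gγ gγ g₁
    rw [vwpSum_inv_one ha, hz₀] at key
    simp only [mul_inv_cancel₀ ha, one_mul, mul_one] at key
    have n₁ := qPochInf_ne_zero hq hz
    have n₂ := qPochInf_ne_zero hq (hmul hγ1)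
    have n₃ := qPochInf_ne_zero hq (hmul hγ2)
    have n₄ := qPochInf_ne_zero hq hq
    rw [div_eq_inv_mul]
    refine mul_left_cancel₀ (mul_ne_zero (mul_ne_zero n₁ (pow_ne_zero 2 n₂))
      (mul_ne_zero (pow_ne_zero 2 n₃) n₄)) ?_
    linear_combination -key

lemma qPoch_natCast (q b : ℂ) (n : ℕ) :
    qPoch q b n = ∏ j ∈ Finset.range n, (1 - b * q ^ j) := by
  simp [qPoch]

lemma qPoch_neg_natCast (q b : ℂ) (n : ℕ) :
    qPoch q b (-n) = (∏ j ∈ Finset.range n, (1 - b * q ^ (-(j : ℤ) - 1)))⁻¹ := by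
  cases n with
  | zero => simp [qPoch]
  | succ n => rw [qPoch, if_neg (by push_cast; omega), neg_neg, Int.toNat_natCast]

lemma wpBilat_eq {q a β : ℂ} (hq : q ≠ 0) (ha : a ≠ 0) (hβ : β ≠ 0)
    (h : ∀ j : ℕ, 1 - β * q ^ (j + 1) ≠ 0) (n : ℤ) :
    wpBilat q a β n = qPoch q β⁻¹ n / qPoch q (a * β * q) n * β ^ n := by
  obtain ⟨n, rfl | rfl⟩ := n.eq_nat_or_neg
  · have hpow : β ^ n = ∏ j ∈ Finset.range n, β := by simp
    rw [wpBilat_natCast, wpProd, qPoch_natCast, qPoch_natCast, zpow_natCast, hpow,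
      ← Finset.prod_div_distrib, ← Finset.prod_mul_distrib]
    refine Finset.prod_congr rfl fun j _ => ?_
    rw [div_mul_eq_mul_div, sub_mul, mul_right_comm β⁻¹, inv_mul_cancel₀ hβ, one_mul, one_mul,
      mul_assoc (a * β), ← pow_succ']
  · have hpow : (β⁻¹) ^ n = ∏ j ∈ Finset.range n, β⁻¹ := by simp
    have hqpow : q ^ n = ∏ j ∈ Finset.range n, q := by simp
    rw [wpBilat_neg_natCast, wpProd, qPoch_neg_natCast, qPoch_neg_natCast, zpow_neg, zpow_natCast,
      ← inv_pow, hpow, hqpow, inv_div_inv, ← Finset.prod_div_distrib, ← Finset.prod_mul_distrib,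
      ← Finset.prod_mul_distrib]
    refine Finset.prod_congr rfl fun j _ => ?_
    have hj := h j
    have hqj : q ^ j ≠ 0 := pow_ne_zero _ hq
    have e₁ : q ^ (-(j : ℤ) - 1) = (q ^ (j + 1))⁻¹ := by
      rw [← zpow_natCast, ← zpow_neg]
      congr 1
      push_cast
      ring
    have e₂ : 1 - β⁻¹ * (q ^ (j + 1))⁻¹ = -(1 - β * q ^ (j + 1)) * (β * q ^ (j + 1))⁻¹ := by
      field_simp
      ring
    rw [e₁, e₂, inv_mul_cancel_left₀ ha]
    field_simp
    ring

lemma tendsto_sum_Icc_neg {f : ℤ → ℂ} (hf : Summable f) :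
    Tendsto (fun N : ℕ => ∑ n ∈ Finset.Icc (-(N : ℤ)) (N : ℤ), f n) atTop (nhds (∑' n, f n)) := by
  refine hf.hasSum.comp (tendsto_atTop_finset_of_monotone (fun M N h => ?_) fun n => ?_)
  · exact Finset.Icc_subset_Icc (by simpa using h) (by simpa using h)
  · exact ⟨n.natAbs, Finset.mem_Icc.2 (by omega)⟩

/-- Bailey's very-well-poised `₆ψ₆` summation formula in the variables
`(B,C,D,E,X)`: the bilateral series `T(X;C)` (as a limit of symmetric partial
sums) equals the stated quotient of infinite `q`-shifted factorials. -/
theorem bailey_6psi6_variant (q B C D E X : ℂ) (hq0 : 0 < ‖q‖) (hq1 : ‖q‖ < 1)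
    (hB : B ≠ 0) (hC : C ≠ 0) (hD : D ≠ 0) (hE : E ≠ 0) (hX : X ≠ 0)
    (hCq : ‖C/q^3‖ < 1)
    (hgen : ∀ n : ℤ, qPoch q X n ≠ 0 ∧ qPoch q (B*C*D*X) n ≠ 0 ∧
      qPoch q (B*C*E*X) n ≠ 0 ∧ qPoch q (C*D*E*X) n ≠ 0)
    (h1 : 1 - B*C*D*E*X^2 ≠ 0)
    (hd1 : qPochInf q X ≠ 0) (hd2 : qPochInf q (1/(B*X)) ≠ 0)
    (hd3 : qPochInf q (1/(D*X)) ≠ 0) (hd4 : qPochInf q (1/(E*X)) ≠ 0)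
    (hd5 : qPochInf q (1/(B*C*D*E*X)) ≠ 0) (hd6 : qPochInf q (C/q^3) ≠ 0)
    (hd7 : qPochInf q (B*C*D*X) ≠ 0) (hd8 : qPochInf q (B*C*E*X) ≠ 0)
    (hd9 : qPochInf q (C*D*E*X) ≠ 0) :
    Filter.Tendsto
      (fun N : ℕ => ∑ n ∈ Finset.Icc (-(N : ℤ)) (N : ℤ), Tterm q B C D E X n) atTop
      (nhds ((qPochInf q q * qPochInf q (1/(B*q)) * qPochInf q (1/(D*q)) *
          qPochInf q (1/(E*q)) * qPochInf q (B*C*D*E*X^2*q) *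
          qPochInf q (q/(B*C*D*E*X^2)) * qPochInf q (B*C/q) * qPochInf q (C*D/q) *
          qPochInf q (C*E/q)) /
        (qPochInf q X * qPochInf q (1/(B*X)) * qPochInf q (1/(D*X)) *
          qPochInf q (1/(E*X)) * qPochInf q (1/(B*C*D*E*X)) * qPochInf q (C/q^3) *
          qPochInf q (B*C*D*X) * qPochInf q (B*C*E*X) * qPochInf q (C*D*E*X)))) := by
  have hq₀ : q ≠ 0 := norm_pos_iff.1 hq0
  set a := B * C * D * E * X ^ 2 with ha_def
  have ha : a ≠ 0 := by simp [*]
  obtain ⟨β, hβ⟩ : ∃ β, β = (B * C * D * E * X * q)⁻¹ := ⟨_, rfl⟩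
  obtain ⟨γ, hγ⟩ : ∃ γ, γ = (B * X * q)⁻¹ := ⟨_, rfl⟩
  obtain ⟨δ, hδ⟩ : ∃ δ, δ = (D * X * q)⁻¹ := ⟨_, rfl⟩
  obtain ⟨ε, hε⟩ : ∃ ε, ε = (E * X * q)⁻¹ := ⟨_, rfl⟩
  have hβ₀ : β ≠ 0 := by simp [*]
  have hγ₀ : γ ≠ 0 := by simp [*]
  have hδ₀ : δ ≠ 0 := by simp [*]
  have hε₀ : ε ≠ 0 := by simp [*]
  have b₁ : β * q = 1 / (B * C * D * E * X) := by rw [hβ]; field_simp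
  have b₂ : γ * q = 1 / (B * X) := by rw [hγ]; field_simp
  have b₃ : δ * q = 1 / (D * X) := by rw [hδ]; field_simp
  have b₄ : ε * q = 1 / (E * X) := by rw [hε]; field_simp
  have d₁ : a * β * q = X := by rw [hβ, ha_def]; field_simp
  have d₂ : a * γ * q = C * D * E * X := by rw [hγ, ha_def]; field_simp
  have d₃ : a * δ * q = B * C * E * X := by rw [hδ, ha_def]; field_simp
  have d₄ : a * ε * q = B * C * D * X := by rw [hε, ha_def]; field_simp
  have p₁ : a * β * γ * q = 1 / (B * q) := by rw [hβ, hγ, ha_def]; field_simp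
  have p₂ : a * β * δ * q = 1 / (D * q) := by rw [hβ, hδ, ha_def]; field_simp
  have p₃ : a * β * ε * q = 1 / (E * q) := by rw [hβ, hε, ha_def]; field_simp
  have p₄ : a * γ * δ * q = C * E / q := by rw [hγ, hδ, ha_def]; field_simp
  have p₅ : a * γ * ε * q = C * D / q := by rw [hγ, hε, ha_def]; field_simp
  have p₆ : a * δ * ε * q = B * C / q := by rw [hδ, hε, ha_def]; field_simp
  have hz : q * a ^ 2 * β * γ * δ * ε = C / q ^ 3 := by
    rw [hβ, hγ, hδ, hε, ha_def]; field_simp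
  have generic : ∀ {x : ℂ}, qPochInf q (x * q) ≠ 0 → qPochInf q (a * x * q) ≠ 0 →
      WpGeneric q a x := fun {x} h h' =>
    ⟨fun j => by convert one_sub_mul_pow_ne_zero h j using 2; ring,
      fun j => by convert one_sub_mul_pow_ne_zero h' j using 2; ring⟩
  have gβ : WpGeneric q a β := generic (by rwa [b₁]) (by rwa [d₁])
  have gγ : WpGeneric q a γ := generic (by rwa [b₂]) (by rwa [d₂])
  have gδ : WpGeneric q a δ := generic (by rwa [b₃]) (by rwa [d₃])
  have gε : WpGeneric q a ε := generic (by rwa [b₄]) (by rwa [d₄])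
  have hz1 : ‖q * a ^ 2 * β * γ * δ * ε‖ < 1 := by rwa [hz]
  have hterm : ∀ n : ℤ, Tterm q B C D E X n = vwpTerm q a β γ δ ε n / (1 - a) := fun n => by
    rw [vwpTerm, wpBilat_eq hq₀ ha hβ₀ gβ.1, wpBilat_eq hq₀ ha hγ₀ gγ.1,
      wpBilat_eq hq₀ ha hδ₀ gδ.1,
      wpBilat_eq hq₀ ha hε₀ gε.1, d₁, d₂, d₃, d₄, hβ, hγ, hδ, hε, inv_inv, inv_inv, inv_inv, inv_inv,
      ← hβ, ← hγ, ← hδ, ← hε, Tterm, ← hz, ← ha_def]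
    simp only [mul_zpow, div_eq_mul_inv, mul_inv]
    ring
  have hsum := tendsto_sum_Icc_neg ((summable_vwpTerm hq₀ hq1 ha hz1).div_const (1 - a))
  simp only [← hterm] at hsum
  convert hsum using 2
  rw [funext hterm, tsum_div_const]
  have key := vwpSum_mul_eq hq₀ hq1 ha hz1 gβ gγ gδ gε
  rw [vwpSum_zero hq₀ hq1 ha, hz, b₁, b₂, b₃, b₄, d₁, d₂, d₃, d₄, p₁, p₂, p₃, p₄, p₅, p₆,
    vwpSum] at key
  rw [div_eq_div_iff (by simp only [mul_ne_zero_iff]; tauto) h1]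
  linear_combination -key
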